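/- Let A be an associative algebra over a field of characteristic zero and let (u_k)_{k≥1} be a sequence in A. Then the formal conjugation intertwines commutators: for all h, f ∈ A and every k ≥ 0, [h, R^{(k)}(f)] = Σ_{m=0}^{k} R^{(m)}( [Q^{(k−m)}(h), f] ), where [a,b] = ab − ba. (This is the coefficient-of-μ^k form of the identity ad_h ∘ R = R ∘ ad_{Qh} for the formal power series Q = Σ_{k≥0} μ^k Q^{(k)} and R = Σ_{k≥0} μ^k R^{(k)}.) -/

import Mathlib

noncomputable section

variable (F : Type*) [Field F] [CharZero F] {A : Type*} [Ring A] [Algebra F A]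

/-- `ad_u : A → A`, `ad_u(a) = u a − a u`, as an `F`-linear map. -/
def adL (u : A) : Module.End F A :=
  LinearMap.mulLeft F u - LinearMap.mulRight F u

/-- The index set `π(k)` of `k`-tuples `(j₁,…,j_k)` of non-negative integers with
`Σ_l l·j_l = k` (each component is then automatically `≤ k`, so we realise the tuples as
functions `Fin k → Fin (k+1)`, `j l` encoding `j_{l+1}`). -/
def pik (k : ℕ) : Finset (Fin k → Fin (k + 1)) :=
  Finset.univ.filter fun j => ∑ l, (l.1 + 1) * (j l).1 = k

/-- `Q^{(k)} = Σ_{j ∈ π(k)} (j₁!⋯j_k!)^{−1} ad_{u_k}^{j_k} ∘ ⋯ ∘ ad_{u_1}^{j_1}`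
(with `Q^{(0)} = id`). -/
def Qop (u : ℕ → A) (k : ℕ) : Module.End F A :=
  ∑ j ∈ pik k, (((∏ l, Nat.factorial (j l).1 : ℕ) : F)⁻¹ : F) •
    ((List.finRange k).reverse.map fun l => adL F (u (l.1 + 1)) ^ (j l).1).prod

/-- `R^{(k)} = Σ_{j ∈ π(k)} ((−1)^{j₁+⋯+j_k} / (j₁!⋯j_k!)) ad_{u_1}^{j_1} ∘ ⋯ ∘ ad_{u_k}^{j_k}`
(with `R^{(0)} = id`). -/
def Rop (u : ℕ → A) (k : ℕ) : Module.End F A :=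
  ∑ j ∈ pik k, ((-1 : F) ^ (∑ l, (j l).1) * (((∏ l, Nat.factorial (j l).1 : ℕ) : F)⁻¹ : F)) •
    ((List.finRange k).map fun l => adL F (u (l.1 + 1)) ^ (j l).1).prod

open Finset PowerSeries in
/-- Sums over an antidiagonal supported on the multiples of `l` are sums over the antidiagonal of
the quotient. -/
theorem sum_antidiagonal_ite_dvd {M : Type*} [AddCommMonoid M] (g : ℕ → ℕ → M) {l : ℕ}
    (hl : 0 < l) (k : ℕ) :
    (∑ p ∈ antidiagonal k, if l ∣ p.1 ∧ l ∣ p.2 then g (p.1 / l) (p.2 / l) else 0) =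
      if l ∣ k then ∑ q ∈ antidiagonal (k / l), g q.1 q.2 else 0 := by
  split_ifs with hk
  · obtain ⟨n, rfl⟩ := hk
    rw [Nat.mul_div_cancel_left n hl, ← sum_filter]
    refine sum_nbij' (fun p => (p.1 / l, p.2 / l)) (fun q => (l * q.1, l * q.2)) ?_ ?_ ?_ ?_ ?_
    · rintro ⟨_, _⟩ hp
      simp only [mem_filter, HasAntidiagonal.mem_antidiagonal] at hp
      obtain ⟨h, ⟨a, rfl⟩, ⟨b, rfl⟩⟩ := hp
      rw [← mul_add] at h
      simpa [Nat.mul_div_cancel_left _ hl] using Nat.eq_of_mul_eq_mul_left hl h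
    · rintro ⟨a, b⟩ hq
      rw [HasAntidiagonal.mem_antidiagonal] at hq
      simp [← hq, mul_add]
    · rintro ⟨_, _⟩ hp
      simp only [mem_filter, HasAntidiagonal.mem_antidiagonal] at hp
      simp [Nat.mul_div_cancel' hp.2.1, Nat.mul_div_cancel' hp.2.2]
    · rintro ⟨a, b⟩ _
      simp [Nat.mul_div_cancel_left _ hl]
    · simp
  · refine sum_eq_zero fun p hp => if_neg fun h => hk ?_
    rw [← HasAntidiagonal.mem_antidiagonal.1 hp]
    exact dvd_add h.1 h.2

/-- The formal power series `exp (d X ^ l)`. -/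
def expSeries {B : Type*} [Ring B] [Algebra F B] (d : B) (l : ℕ) : PowerSeries B :=
  PowerSeries.mk fun k => if l ∣ k then ((Nat.factorial (k / l) : F)⁻¹) • d ^ (k / l) else 0

section

variable {B : Type*} [Ring B] [Algebra F B]

open Finset PowerSeries

omit [CharZero F] in
theorem expSeries_zero {l : ℕ} (hl : 0 < l) : expSeries F (0 : B) l = 1 := by
  ext k
  rw [expSeries, coeff_mk, coeff_one]
  rcases eq_or_ne k 0 with rfl | hk
  · simp
  · rw [if_neg hk]
    split_ifs with h
    · rw [zero_pow (Nat.div_pos (Nat.le_of_dvd (Nat.pos_of_ne_zero hk) h) hl).ne', smul_zero]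
    · rfl

theorem expSeries_add {a b : B} (hab : Commute a b) {l : ℕ} (hl : 0 < l) :
    expSeries F (a + b) l = expSeries F a l * expSeries F b l := by
  ext k
  rw [coeff_mul]
  simp only [expSeries, coeff_mk]
  have key := sum_antidiagonal_ite_dvd (fun i j =>
    (((Nat.factorial i : F)⁻¹) • a ^ i) * (((Nat.factorial j : F)⁻¹) • b ^ j)) hl k
  simp only [ite_and] at key
  simp only [ite_mul, mul_ite, zero_mul, mul_zero]
  refine Eq.symm ((sum_congr rfl fun p _ => ?_).trans (key.trans ?_))
  · split_ifs <;> rfl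
  symm
  refine if_congr Iff.rfl ?_ rfl
  rw [hab.add_pow', smul_sum]
  refine sum_congr rfl fun q hq => ?_
  rw [HasAntidiagonal.mem_antidiagonal] at hq
  rw [smul_mul_smul_comm, ← Nat.cast_smul_eq_nsmul F, smul_smul]
  congr 1
  rw [← hq, Nat.cast_add_choose]
  have := Nat.cast_ne_zero (R := F).2 (Nat.factorial_ne_zero (q.1 + q.2))
  field_simp

theorem expSeries_neg_mul_self (d : B) {l : ℕ} (hl : 0 < l) :
    expSeries F (-d) l * expSeries F d l = 1 := by
  rw [← expSeries_add F (Commute.neg_left rfl) hl, neg_add_cancel, expSeries_zero F hl]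

omit [CharZero F] in
theorem coeff_expSeries_of_lt (d : B) {l m : ℕ} (h : m < l) :
    coeff m (expSeries F d l) = coeff m (1 : PowerSeries B) := by
  rw [expSeries, coeff_mk, coeff_one]
  rcases eq_or_ne m 0 with rfl | hm
  · simp
  · rw [if_neg hm, if_neg (Nat.not_dvd_of_pos_of_lt (Nat.pos_of_ne_zero hm) h)]

/-- Up to degree `k`, the series `exp (d X ^ l)` is the sum of its first `k + 1` terms. -/
theorem coeff_expSeries_of_le (d : B) {l m k : ℕ} (hl : 0 < l) (h : m ≤ k) :
    coeff m (expSeries F d l) = coeff m (∑ j : Fin (k + 1),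
      monomial (l * j.1) (((Nat.factorial j.1 : F)⁻¹) • d ^ j.1)) := by
  rw [expSeries, coeff_mk, map_sum]
  simp only [coeff_monomial]
  split_ifs with hd
  · obtain ⟨n, rfl⟩ := hd
    have hn : n < k + 1 := by nlinarith
    rw [Finset.sum_eq_single ⟨n, hn⟩]
    · simp [Nat.mul_div_cancel_left _ hl]
    · intro b _ hb
      refine if_neg fun h' => hb (Fin.ext ?_)
      exact (Nat.eq_of_mul_eq_mul_left hl h').symm
    · simp
  · refine (sum_eq_zero fun j _ => if_neg ?_).symm
    rintro rfl
    exact hd (dvd_mul_right _ _)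

end

section

open Finset PowerSeries

theorem coeff_mul_congr {B : Type*} [Semiring B] {φ φ' ψ ψ' : PowerSeries B} {k : ℕ}
    (hφ : ∀ m ≤ k, coeff m φ = coeff m φ') (hψ : ∀ m ≤ k, coeff m ψ = coeff m ψ') :
    ∀ m ≤ k, coeff m (φ * ψ) = coeff m (φ' * ψ') := by
  intro m hm
  rw [coeff_mul, coeff_mul]
  refine sum_congr rfl fun p hp => ?_
  rw [HasAntidiagonal.mem_antidiagonal] at hp
  rw [hφ _ (by omega), hψ _ (by omega)]

theorem coeff_list_prod_congr {B ι : Type*} [Semiring B] {f g : ι → PowerSeries B} {k : ℕ}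
    (L : List ι) (h : ∀ i, ∀ m ≤ k, coeff m (f i) = coeff m (g i)) :
    ∀ m ≤ k, coeff m (L.map f).prod = coeff m (L.map g).prod := by
  induction L with
  | nil => simp
  | cons i L ih => simpa using coeff_mul_congr (h i) ih

theorem list_prod_map_monomial {B ι : Type*} [Semiring B] (L : List ι) (w : ι → ℕ) (b : ι → B) :
    (L.map fun i => monomial (w i) (b i)).prod = monomial (L.map w).sum (L.map b).prod := by
  induction L with
  | nil => simp [monomial_zero_eq_C_apply]
  | cons i L ih => simp [ih, monomial_mul_monomial]

theorem list_prod_map_smul {K B ι : Type*} [CommSemiring K] [Semiring B] [Algebra K B]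
    (L : List ι) (c : ι → K) (b : ι → B) :
    (L.map fun i => c i • b i).prod = (L.map c).prod • (L.map b).prod := by
  induction L with
  | nil => simp
  | cons i L ih =>
    rw [List.map_cons, List.prod_cons, ih, smul_mul_smul_comm]
    simp

theorem list_prod_map_perm_sum {B : Type*} [Ring B] {n : ℕ} {κ : Type*} [Fintype κ]
    (σ : Equiv.Perm (Fin n)) (g : Fin n → κ → B) :
    ((List.finRange n).map fun i => ∑ j, g (σ i) j).prod =
      ∑ r : Fin n → κ, ((List.finRange n).map fun i => g (σ i) (r (σ i))).prod := by
  classical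
  have := MultilinearMap.map_sum
    ((MultilinearMap.mkPiAlgebraFin ℤ n B).domDomCongr σ) (fun i (j : κ) => g i j)
  simpa [List.ofFn_eq_map] using this

theorem coeff_list_prod_expSeries {B : Type*} [Ring B] [Algebra F B] {k : ℕ}
    (σ : Equiv.Perm (Fin k)) (d : ℕ → B) :
    coeff k ((List.finRange k).map fun i => expSeries F (d (σ i).1) ((σ i).1 + 1)).prod =
      ∑ j ∈ pik k, (((∏ l, Nat.factorial (j l).1 : ℕ) : F)⁻¹ : F) •
        ((List.finRange k).map fun i => d (σ i).1 ^ (j (σ i)).1).prod := by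
  rw [coeff_list_prod_congr _
    (fun i m hm => coeff_expSeries_of_le F (d (σ i).1) (Nat.succ_pos (σ i).1) hm) k le_rfl,
    list_prod_map_perm_sum σ (fun (i : Fin k) (j : Fin (k + 1)) =>
      monomial ((i.1 + 1) * j.1) (((Nat.factorial j.1 : F)⁻¹) • d i.1 ^ j.1)), map_sum, pik,
    sum_filter]
  refine sum_congr rfl fun j _ => ?_
  rw [list_prod_map_monomial, coeff_monomial, list_prod_map_smul, ← List.ofFn_eq_map,
    ← List.ofFn_eq_map, List.sum_ofFn, List.prod_ofFn,
    Equiv.sum_comp σ (fun i => (i.1 + 1) * (j i).1),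
    Equiv.prod_comp σ (fun i => ((Nat.factorial (j i).1 : F)⁻¹))]
  simp [eq_comm]

/-- The formal product `exp (d₀ X) exp (d₁ X²) ⋯ exp (dₙ₋₁ Xⁿ)`. -/
def expProd {B : Type*} [Ring B] [Algebra F B] (d : ℕ → B) (n : ℕ) : PowerSeries B :=
  ((List.range n).map fun i => expSeries F (d i) (i + 1)).prod

/-- The formal product `exp (dₙ₋₁ Xⁿ) ⋯ exp (d₁ X²) exp (d₀ X)`. -/
def expProdRev {B : Type*} [Ring B] [Algebra F B] (d : ℕ → B) (n : ℕ) : PowerSeries B :=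
  ((List.range n).reverse.map fun i => expSeries F (d i) (i + 1)).prod

section

variable {B : Type*} [Ring B] [Algebra F B] (d : ℕ → B)

omit [CharZero F] in
theorem expProd_succ (n : ℕ) :
    expProd F d (n + 1) = expProd F d n * expSeries F (d n) (n + 1) := by
  simp [expProd, List.range_succ]

omit [CharZero F] in
theorem expProdRev_succ (n : ℕ) :
    expProdRev F d (n + 1) = expSeries F (d n) (n + 1) * expProdRev F d n := by
  simp [expProdRev, List.range_succ]

theorem expProd_neg_mul_expProdRev (n : ℕ) :
    expProd F (fun i => -d i) n * expProdRev F d n = 1 := by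
  induction n with
  | zero => simp [expProd, expProdRev]
  | succ n ih =>
    rw [expProd_succ, expProdRev_succ, mul_assoc, ← mul_assoc (expSeries F (-d n) (n + 1)),
      expSeries_neg_mul_self F _ n.succ_pos, one_mul, ih]

omit [CharZero F] in
theorem coeff_expProd_of_le {m n : ℕ} (h : m ≤ n) :
    coeff m (expProd F d n) = coeff m (expProd F d m) := by
  induction n, h using Nat.le_induction with
  | base => rfl
  | succ n hn ih =>
    rw [expProd_succ, coeff_mul_congr (k := n) (ψ' := 1) (fun _ _ => rfl)
      (fun i hi => coeff_expSeries_of_lt F _ (Nat.lt_succ_of_le hi)) m hn, mul_one, ih]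

omit [CharZero F] in
theorem coeff_expProdRev_of_le {m n : ℕ} (h : m ≤ n) :
    coeff m (expProdRev F d n) = coeff m (expProdRev F d m) := by
  induction n, h using Nat.le_induction with
  | base => rfl
  | succ n hn ih =>
    rw [expProdRev_succ, coeff_mul_congr (k := n) (φ' := 1)
      (fun i hi => coeff_expSeries_of_lt F _ (Nat.lt_succ_of_le hi)) (fun _ _ => rfl) m hn,
      one_mul, ih]

end

theorem coeff_expProd_adL (u : ℕ → A) {m n : ℕ} (h : m ≤ n) :
    coeff m (expProd F (fun i => -adL F (u (i + 1))) n) = Rop F u m := by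
  have key := coeff_list_prod_expSeries F (Equiv.refl (Fin m)) (fun i => -adL F (u (i + 1)))
  rw [coeff_expProd_of_le F _ h, expProd, ← List.map_coe_finRange_eq_range, List.map_map]
  refine key.trans (sum_congr rfl fun j _ => ?_)
  have hneg : ∀ i : Fin m, (-adL F (u (i.1 + 1))) ^ (j i).1 =
      (-1 : F) ^ (j i).1 • adL F (u (i.1 + 1)) ^ (j i).1 := fun i => by
    rw [← smul_pow, neg_one_smul]
  simp only [Equiv.refl_apply, hneg]
  rw [list_prod_map_smul, smul_smul, mul_comm, ← List.ofFn_eq_map, List.prod_ofFn,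
    prod_pow_eq_pow_sum]

theorem coeff_expProdRev_adL (u : ℕ → A) {m n : ℕ} (h : m ≤ n) :
    coeff m (expProdRev F (fun i => adL F (u (i + 1))) n) = Qop F u m := by
  have key := coeff_list_prod_expSeries F (Fin.revPerm (n := m)) (fun i => adL F (u (i + 1)))
  rw [coeff_expProdRev_of_le F _ h, expProdRev, ← List.map_coe_finRange_eq_range,
    ← List.map_reverse, List.map_map, List.finRange_reverse, List.map_map]
  refine key.trans (sum_congr rfl fun j _ => ?_)
  rw [List.finRange_reverse, List.map_map]
  rfl

/-- The action of a power series of endomorphisms on a power series of vectors, by convolution. -/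
def seriesAct (S : PowerSeries (Module.End F A)) (φ : PowerSeries A) : PowerSeries A :=
  PowerSeries.mk fun k => ∑ p ∈ antidiagonal k, coeff p.1 S (coeff p.2 φ)

omit [CharZero F] in
theorem coeff_seriesAct (S : PowerSeries (Module.End F A)) (φ : PowerSeries A) (k : ℕ) :
    coeff k (seriesAct F S φ) = ∑ p ∈ antidiagonal k, coeff p.1 S (coeff p.2 φ) :=
  coeff_mk _ _

omit [CharZero F] in
theorem coeff_seriesAct_C (S : PowerSeries (Module.End F A)) (a : A) (k : ℕ) :
    coeff k (seriesAct F S (C a)) = coeff k S a := by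
  rw [coeff_seriesAct, sum_eq_single (k, 0)]
  · simp
  · rintro ⟨i, j⟩ hp hne
    rw [HasAntidiagonal.mem_antidiagonal] at hp
    have hj : j ≠ 0 := by
      rintro rfl
      exact hne (by simpa using hp)
    simp [coeff_C, hj]
  · simp

omit [CharZero F] in
theorem seriesAct_sub (S : PowerSeries (Module.End F A)) (φ ψ : PowerSeries A) :
    seriesAct F S (φ - ψ) = seriesAct F S φ - seriesAct F S ψ := by
  ext k
  simp [coeff_seriesAct]

omit [CharZero F] in
theorem seriesAct_one (φ : PowerSeries A) : seriesAct F 1 φ = φ := by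
  ext k
  rw [coeff_seriesAct, sum_eq_single (0, k)]
  · simp
  · rintro ⟨i, j⟩ hp hne
    rw [HasAntidiagonal.mem_antidiagonal] at hp
    have hi : i ≠ 0 := by
      rintro rfl
      exact hne (by simpa using hp)
    simp [coeff_one, hi]
  · simp

omit [CharZero F] in
theorem seriesAct_mul (S T : PowerSeries (Module.End F A)) (φ : PowerSeries A) :
    seriesAct F (S * T) φ = seriesAct F S (seriesAct F T φ) := by
  ext k
  simp only [coeff_seriesAct, coeff_mul, LinearMap.sum_apply, map_sum, Module.End.mul_apply]
  rw [sum_sigma', sum_sigma']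
  refine sum_nbij' (fun x => ⟨(x.2.1, x.2.2 + x.1.2), (x.2.2, x.1.2)⟩)
    (fun x => ⟨(x.1.1 + x.2.1, x.2.2), (x.1.1, x.2.1)⟩) ?_ ?_ ?_ ?_ ?_ <;>
  rintro ⟨⟨a, b⟩, ⟨c, d⟩⟩ <;> simp only [mem_sigma, HasAntidiagonal.mem_antidiagonal] <;> grind

omit [CharZero F] in
theorem seriesAct_expSeries_mulLeft (a : A) (l : ℕ) (φ : PowerSeries A) :
    seriesAct F (expSeries F (LinearMap.mulLeft F a) l) φ = expSeries F a l * φ := by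
  ext k
  rw [coeff_seriesAct, coeff_mul]
  refine sum_congr rfl fun p _ => ?_
  simp only [expSeries, coeff_mk]
  split_ifs <;> simp [LinearMap.pow_mulLeft]

omit [CharZero F] in
theorem seriesAct_expSeries_mulRight (a : A) (l : ℕ) (φ : PowerSeries A) :
    seriesAct F (expSeries F (LinearMap.mulRight F a) l) φ = φ * expSeries F a l := by
  ext k
  rw [coeff_seriesAct, coeff_mul, ← Nat.sum_antidiagonal_swap]
  refine sum_congr rfl fun p _ => ?_
  simp only [expSeries, coeff_mk, Prod.fst_swap, Prod.snd_swap]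
  split_ifs <;> simp [LinearMap.pow_mulRight]

theorem seriesAct_expSeries_adL (a : A) {l : ℕ} (hl : 0 < l) (φ : PowerSeries A) :
    seriesAct F (expSeries F (adL F a) l) φ = expSeries F a l * φ * expSeries F (-a) l := by
  have hadd : adL F a = LinearMap.mulLeft F a + LinearMap.mulRight F (-a) := by
    ext x
    simp [adL, sub_eq_add_neg]
  rw [hadd, expSeries_add F (LinearMap.commute_mulLeft_right a (-a)) hl, seriesAct_mul,
    seriesAct_expSeries_mulRight, seriesAct_expSeries_mulLeft, mul_assoc]

theorem seriesAct_expSeries_neg_adL_map_mul (a : A) {l : ℕ} (hl : 0 < l) (φ ψ : PowerSeries A) :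
    seriesAct F (expSeries F (-adL F a) l) (φ * ψ) =
      seriesAct F (expSeries F (-adL F a) l) φ * seriesAct F (expSeries F (-adL F a) l) ψ := by
  have hneg : -adL F a = adL F (-a) := by
    ext x
    simp [adL]
    abel
  have hinv : expSeries F (-(-a)) l * expSeries F (-a) l = 1 := expSeries_neg_mul_self F _ hl
  simp only [hneg, seriesAct_expSeries_adL F _ hl]
  calc
    _ = expSeries F (-a) l * φ * 1 * ψ * expSeries F (-(-a)) l := by simp only [mul_one, mul_assoc]
    _ = _ := by
      rw [← hinv]
      simp only [mul_assoc]

theorem seriesAct_expProd_neg_adL_map_mul (u : ℕ → A) (n : ℕ) (φ ψ : PowerSeries A) :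
    seriesAct F (expProd F (fun i => -adL F (u (i + 1))) n) (φ * ψ) =
      seriesAct F (expProd F (fun i => -adL F (u (i + 1))) n) φ *
        seriesAct F (expProd F (fun i => -adL F (u (i + 1))) n) ψ := by
  induction n generalizing φ ψ with
  | zero => simp [expProd, seriesAct_one]
  | succ n ih =>
    simp only [expProd_succ, seriesAct_mul]
    rw [seriesAct_expSeries_neg_adL_map_mul F _ n.succ_pos, ih]

end

/-- The formal conjugation intertwines commutators: for all `h, f ∈ A` and
every `k ≥ 0`, `[h, R^{(k)}(f)] = Σ_{m=0}^{k} R^{(m)}([Q^{(k−m)}(h), f])`, the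
coefficient-of-`μ^k` form of `ad_h ∘ R = R ∘ ad_{Qh}`. -/
theorem adjoint_intertwines_R (u : ℕ → A) (h f : A) (k : ℕ) :
    h * Rop F u k f - Rop F u k f * h =
      ∑ m ∈ Finset.range (k + 1),
        Rop F u m (Qop F u (k - m) h * f - f * Qop F u (k - m) h) := by
  set S := expProd F (fun i => -adL F (u (i + 1))) k with hS
  set T := expProdRev F (fun i => adL F (u (i + 1))) k with hT
  have hST : seriesAct F S (seriesAct F T (PowerSeries.C h)) = PowerSeries.C h := by
    rw [← seriesAct_mul, hS, hT, expProd_neg_mul_expProdRev, seriesAct_one]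
  have key : seriesAct F S (seriesAct F T (PowerSeries.C h) * PowerSeries.C f -
      PowerSeries.C f * seriesAct F T (PowerSeries.C h)) =
      PowerSeries.C h * seriesAct F S (PowerSeries.C f) -
        seriesAct F S (PowerSeries.C f) * PowerSeries.C h := by
    rw [seriesAct_sub, seriesAct_expProd_neg_adL_map_mul, seriesAct_expProd_neg_adL_map_mul, hST]
  have hk := congrArg (PowerSeries.coeff k) key
  rw [map_sub, PowerSeries.coeff_C_mul, PowerSeries.coeff_mul_C, coeff_seriesAct_C, hS,
    coeff_expProd_adL F u le_rfl] at hk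
  rw [← hk, coeff_seriesAct, Finset.Nat.sum_antidiagonal_eq_sum_range_succ_mk]
  refine Finset.sum_congr rfl fun m hm => ?_
  rw [Finset.mem_range] at hm
  simp only [map_sub, PowerSeries.coeff_C_mul, PowerSeries.coeff_mul_C, coeff_seriesAct_C]
  rw [hT, coeff_expProd_adL F u (by omega), coeff_expProdRev_adL F u (Nat.sub_le k m)]
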